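/- Let (X, 𝒳) be a measurable space and Γ a finite nonempty index set. For each γ ∈ Γ, let P_γ be a Markov kernel on X of the form P_γ(x, A) = (1/L_γ) Σ_{l=1}^{L_γ} Q_{γ,l}(x, A) for Markov kernels Q_{γ,l}, each P_γ admitting the common stationary probability distribution π. Suppose that for each γ there exist ξ_γ ∈ (0, 1] and a probability measure ν_γ such that Q_{γ,1}(x, A) ≥ ξ_γ · ν_γ(A) for all x ∈ X and all measurable A. Then the family {P_γ}_{γ ∈ Γ} is simultaneously uniformly ergodic: there exist R < ∞ and ρ ∈ (0, 1) such that sup over measurable sets A of |P_γⁿ(x, A) − π(A)| ≤ R · ρⁿ for all γ ∈ Γ, all x ∈ X, and all n ∈ ℕ. (One may take ρ = max_{γ ∈ Γ} (1 − ξ_γ / L_γ).) -/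

import Mathlib

open MeasureTheory ProbabilityTheory
open scoped ENNReal

/-- The `n`-step kernel `Pⁿ`, obtained by composing `P` with itself `n` times. -/
noncomputable def Kernel.iterate {X : Type*} [MeasurableSpace X]
    (P : ProbabilityTheory.Kernel X X) : ℕ → ProbabilityTheory.Kernel X X
  | 0 => ProbabilityTheory.Kernel.id
  | n + 1 => P ∘ₖ Kernel.iterate P n


lemma aux_markov {X : Type*} [MeasurableSpace X] (P : Kernel X X) [IsMarkovKernel P] (n : ℕ) :
    IsMarkovKernel (Kernel.iterate P n) := by
  induction n with
  | zero => unfold Kernel.iterate; infer_instance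
  | succ n ih => unfold Kernel.iterate; infer_instance

lemma aux_comm {X : Type*} [MeasurableSpace X] (P : Kernel X X) (n : ℕ) :
    Kernel.iterate P (n + 1) = Kernel.iterate P n ∘ₖ P := by
  induction n with
  | zero => simp [Kernel.iterate, Kernel.comp_id, Kernel.id_comp]
  | succ n ih =>
    calc Kernel.iterate P (n + 1 + 1) = P ∘ₖ Kernel.iterate P (n + 1) := rfl
      _ = P ∘ₖ (Kernel.iterate P n ∘ₖ P) := by rw [ih]
      _ = (P ∘ₖ Kernel.iterate P n) ∘ₖ P := (Kernel.comp_assoc _ _ _).symm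

lemma aux_inv {X : Type*} [MeasurableSpace X] (P : Kernel X X) (π : Measure X)
    (h : Kernel.Invariant P π) (n : ℕ) : Kernel.Invariant (Kernel.iterate P n) π := by
  induction n with
  | zero => simp [Kernel.iterate, Kernel.Invariant]
  | succ n ih => exact h.comp ih

lemma aux_int {X : Type*} [MeasurableSpace X] (K : Kernel X X) [IsMarkovKernel K]
    (μ : Measure X) [IsFiniteMeasure μ] {A : Set X} (hA : MeasurableSet A) :
    Integrable (fun x => (K x A).toReal) μ := by
  refine Integrable.of_bound (C := 1)
    (K.measurable_coe hA).ennreal_toReal.aestronglyMeasurable (ae_of_all _ fun x => ?_)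
  rw [Real.norm_of_nonneg ENNReal.toReal_nonneg]
  exact ENNReal.toReal_le_of_le_ofReal zero_le_one (by simpa using prob_le_one)

lemma aux_lint {X : Type*} [MeasurableSpace X] (K : Kernel X X) [IsMarkovKernel K]
    (μ : Measure X) {A : Set X} (hA : MeasurableSet A) :
    (∫⁻ x, K x A ∂μ).toReal = ∫ x, (K x A).toReal ∂μ :=
  (integral_toReal (K.measurable_coe hA).aemeasurable
    (ae_of_all _ fun _ => measure_lt_top _ _)).symm

lemma aux_minor {X : Type*} [MeasurableSpace X] (μ ν : Measure X) [IsProbabilityMeasure μ]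
    [IsProbabilityMeasure ν] (e : ℝ) (he : 0 ≤ e) (hmin : ENNReal.ofReal e • ν ≤ μ)
    (f : X → ℝ) (hf0 : ∀ x, 0 ≤ f x) (hf : Integrable f μ) :
    e * ∫ x, f x ∂ν ≤ ∫ x, f x ∂μ := by
  have := integral_mono_measure hmin (ae_of_all _ hf0) hf
  rwa [integral_smul_measure, ENNReal.toReal_ofReal he, smul_eq_mul] at this

lemma aux_osc {X : Type*} [MeasurableSpace X] (P : Kernel X X) [IsMarkovKernel P]
    (ν : Measure X) [IsProbabilityMeasure ν] (e : ℝ) (he : 0 ≤ e)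
    (hmin : ∀ x, ENNReal.ofReal e • ν ≤ P x) {A : Set X} (hA : MeasurableSet A) (n : ℕ) :
    ∃ a : ℝ, ∀ x, a ≤ (Kernel.iterate P n x A).toReal ∧
      (Kernel.iterate P n x A).toReal ≤ a + (1 - e) ^ n := by
  have := aux_markov P
  induction n with
  | zero =>
    refine ⟨0, fun x => ⟨ENNReal.toReal_nonneg, ?_⟩⟩
    simpa using ENNReal.toReal_le_of_le_ofReal zero_le_one (by simpa using prob_le_one)
  | succ n ih =>
    obtain ⟨a, ha⟩ := ih
    set f : X → ℝ := fun x => (Kernel.iterate P n x A).toReal with hf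
    have hi : ∀ (μ : Measure X) [IsFiniteMeasure μ], Integrable f μ :=
      fun μ _ => aux_int _ μ hA
    refine ⟨a + e * (∫ x, f x ∂ν - a), fun x => ?_⟩
    have hx : (Kernel.iterate P (n + 1) x A).toReal = ∫ y, f y ∂(P x) := by
      rw [aux_comm, Kernel.comp_apply' _ _ _ hA, aux_lint _ _ hA]
    rw [hx]
    have h1 := aux_minor (P x) ν e he (hmin x) (fun y => f y - a)
      (fun y => sub_nonneg.2 (ha y).1) ((hi _).sub (integrable_const _))
    have h2 := aux_minor (P x) ν e he (hmin x) (fun y => (a + (1 - e) ^ n) - f y)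
      (fun y => sub_nonneg.2 (ha y).2) ((integrable_const _).sub (hi _))
    rw [integral_sub (hi _) (integrable_const _), integral_sub (hi _) (integrable_const _)] at h1
    rw [integral_sub (integrable_const _) (hi _), integral_sub (integrable_const _) (hi _)] at h2
    simp only [integral_const, probReal_univ, one_smul] at h1 h2
    rw [pow_succ]
    constructor <;> linarith

lemma aux_main {X : Type*} [MeasurableSpace X] (P : Kernel X X) [IsMarkovKernel P]
    (π : Measure X) [IsProbabilityMeasure π] (hπ : Kernel.Invariant P π)
    (ν : Measure X) [IsProbabilityMeasure ν] (e : ℝ) (he : 0 ≤ e)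
    (hmin : ∀ x, ENNReal.ofReal e • ν ≤ P x) {A : Set X} (hA : MeasurableSet A) (n : ℕ) (x : X) :
    |(Kernel.iterate P n x A).toReal - (π A).toReal| ≤ (1 - e) ^ n := by
  have := aux_markov P
  obtain ⟨a, ha⟩ := aux_osc P ν e he hmin hA n
  have h : (π A).toReal = ∫ y, (Kernel.iterate P n y A).toReal ∂π := by
    rw [← aux_lint _ _ hA, ← Measure.bind_apply hA (Kernel.aemeasurable _),
      (aux_inv P π hπ n).def]
  have h1 : a ≤ (π A).toReal := by
    rw [h]
    simpa using integral_mono (integrable_const a) (aux_int _ π hA) (fun y => (ha y).1)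
  have h2 : (π A).toReal ≤ a + (1 - e) ^ n := by
    rw [h]
    simpa using integral_mono (aux_int _ π hA) (integrable_const (a + (1 - e) ^ n))
      (fun y => (ha y).2)
  have := ha x
  rw [abs_le]
  constructor <;> linarith [this.1, this.2]

/-- **Simultaneous uniform ergodicity of a finite family of mixture kernels with a
minorized first component.**
For each `γ` in a finite nonempty index set, let
`P_γ(x, A) = (1/L_γ) ∑_{l=1}^{L_γ} Q_{γ,l}(x, A)` be a uniform mixture of Markov kernels
admitting the common stationary distribution `π`, and suppose the first component
satisfies the whole-space minorization `Q_{γ,1}(x, A) ≥ ξ_γ ν_γ(A)` with `ξ_γ ∈ (0, 1]`.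
Then the family `{P_γ}` is simultaneously uniformly ergodic: there exist `R < ∞` and
`ρ ∈ (0, 1)` with `sup_A |P_γⁿ(x, A) − π(A)| ≤ R ρⁿ` for all `γ`, `x`, and `n`. -/
theorem mixture_family_simultaneously_uniformly_ergodic
    {X : Type*} [MeasurableSpace X]
    {Γ : Type*} [Fintype Γ] [Nonempty Γ]
    (L : Γ → ℕ) (hL : ∀ γ, 0 < L γ)
    (Q : (γ : Γ) → Fin (L γ) → Kernel X X) (hQ : ∀ γ l, IsMarkovKernel (Q γ l))
    (P : Γ → Kernel X X) (hPmk : ∀ γ, IsMarkovKernel (P γ))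
    (hP : ∀ γ, ∀ x : X, ∀ A : Set X, MeasurableSet A →
      P γ x A = ((L γ : ℝ≥0∞))⁻¹ * ∑ l : Fin (L γ), Q γ l x A)
    (π : Measure X) (hπ : IsProbabilityMeasure π)
    (hstat : ∀ γ, ∀ A : Set X, MeasurableSet A → ∫⁻ x, P γ x A ∂π = π A)
    (ξ : Γ → ℝ≥0∞) (hξ : ∀ γ, 0 < ξ γ) (hξ1 : ∀ γ, ξ γ ≤ 1)
    (ν : Γ → Measure X) (hν : ∀ γ, IsProbabilityMeasure (ν γ))
    (hmin : ∀ γ, ∀ x : X, ∀ A : Set X, MeasurableSet A →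
      ξ γ * ν γ A ≤ Q γ ⟨0, hL γ⟩ x A) :
    ∃ R : ℝ, ∃ ρ : ℝ, ρ ∈ Set.Ioo (0 : ℝ) 1 ∧
      ∀ γ, ∀ n : ℕ, ∀ x : X, ∀ A : Set X, MeasurableSet A →
        |(Kernel.iterate (P γ) n x A).toReal - (π A).toReal| ≤ R * ρ ^ n := by
  have hη : ∀ γ, 0 < (L γ : ℝ≥0∞)⁻¹ * ξ γ := fun γ =>
    ENNReal.mul_pos (ENNReal.inv_ne_zero.2 (ENNReal.natCast_ne_top _)) (hξ γ).ne'
  have hη1 : ∀ γ, (L γ : ℝ≥0∞)⁻¹ * ξ γ ≤ 1 := fun γ =>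
    mul_le_one' (ENNReal.inv_le_one.2 (by exact_mod_cast hL γ)) (hξ1 γ)
  have hηt : ∀ γ, (L γ : ℝ≥0∞)⁻¹ * ξ γ ≠ ∞ := fun γ => ne_top_of_le_ne_top ENNReal.one_ne_top (hη1 γ)
  set e : Γ → ℝ := fun γ => ((L γ : ℝ≥0∞)⁻¹ * ξ γ).toReal with he
  have he0 : ∀ γ, 0 < e γ := fun γ => ENNReal.toReal_pos (hη γ).ne' (hηt γ)
  have he1 : ∀ γ, e γ ≤ 1 := fun γ =>
    ENNReal.toReal_le_of_le_ofReal zero_le_one (by simpa using hη1 γ)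
  obtain ⟨γ₀, hγ₀⟩ := Finite.exists_min e
  refine ⟨1, max (1 / 2) (1 - e γ₀), ⟨by positivity, max_lt (by norm_num) (by linarith [he0 γ₀])⟩, ?_⟩
  intro γ n x A hA
  have := hν γ
  have := hPmk γ
  have hmin' : ∀ x, ENNReal.ofReal (e γ) • ν γ ≤ P γ x := by
    intro x
    refine Measure.le_iff.2 fun B hB => ?_
    rw [ENNReal.ofReal_toReal (hηt γ), hP γ x B hB, Measure.smul_apply, smul_eq_mul, mul_assoc]
    gcongr
    exact (hmin γ x B hB).trans
      (Finset.single_le_sum (f := fun l => Q γ l x B) (fun _ _ => zero_le) (Finset.mem_univ _))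
  have hinv : Kernel.Invariant (P γ) π := by
    refine Measure.ext fun B hB => ?_
    rw [Measure.bind_apply hB (Kernel.aemeasurable _), hstat γ B hB]
  refine (aux_main (P γ) π hinv (ν γ) (e γ) (he0 γ).le hmin' hA n x).trans ?_
  rw [one_mul]
  refine pow_le_pow_left₀ (by linarith [he1 γ]) ?_ n
  exact le_max_of_le_right (by linarith [hγ₀ γ])
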